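/- Let d ≥ 1 and let {V_p}_{p≥2}, V_p : (ℝ^d)^p → ℝ, be a family of p-body potentials satisfying assumptions A1–A4 with respect to a partition of ℝ^d into cubes of side λ. Suppose the two-body part U^(2)(γ) = Σ_{{x,y}⊂γ} V_2(x,y) is superstable for this partition, i.e. there exist A > 0, B_2 ≥ 0 with U^(2)(γ) ≥ A Σ_Δ |γ_Δ|² − B_2|γ| for every finite configuration γ. If for every p > 2 one has (1) V_p^p(Δ)/p^p − p·I_p^{1|p−1}(Δ) ≥ 0 for every cube Δ, and (2) Σ_{p>2} p^{p+1} I_p^{1|p−1}(Δ) < +∞, then the full interaction is superstable: U(γ) ≥ A Σ_Δ |γ_Δ|² − B|γ| for every finite configuration γ, with B = B_2 + Σ_{p>2} p^{p+1} I_p^{1|p−1}. -/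

import Mathlib

open MeasureTheory
open scoped ENNReal BigOperators

noncomputable section

/-- Points of `ℝ^d`. -/
abbrev Pt (d : ℕ) := EuclideanSpace ℝ (Fin d)

/-- The elementary cube with rib `lam` centered at the lattice point `lam • r`. -/
def cube (d : ℕ) (lam : ℝ) (r : Fin d → ℤ) : Set (Pt d) :=
  {x | ∀ i, lam * ((r i : ℝ) - 1 / 2) ≤ x i ∧ x i < lam * ((r i : ℝ) + 1 / 2)}

open scoped Classical in
/-- `|γ_Δ|`: the number of points of the finite configuration `γ` in the cube labelled `r`. -/
def occupancy (d : ℕ) (lam : ℝ) (γ : Finset (Pt d)) (r : Fin d → ℤ) : ℕ :=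
  (γ.filter fun x => x ∈ cube d lam r).card

/-- Concatenate a `k`-tuple and a `(p-k)`-tuple into a `p`-tuple. -/
def joinAt {α : Type*} (p k : ℕ) (h : k ≤ p) (y : Fin k → α) (z : Fin (p - k) → α) :
    Fin p → α :=
  fun i => Fin.append y z (Fin.cast ((Nat.add_sub_cancel' h).symm) i)

/-- The set of (ordered) pairs `i < j` in `Fin p`. -/
def pairs (p : ℕ) : Finset (Fin p × Fin p) := Finset.univ.filter fun q => q.1 < q.2

/-- `Σ_{1 ≤ i < j ≤ p} |x_i - x_j|`. -/
def pairSum (p : ℕ) (x : Fin p → ℝ) : ℝ := ∑ q ∈ pairs p, |x q.1 - x q.2|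

/-- `I_p^{k_1,…,k_n}(Δ_1,…,Δ_n)`: the sup of `|V_p^-|` over choices of `k_1` points in the
cube labelled `r 1`, …, `k_n` points in the cube labelled `r n`. -/
def IblocksT (d : ℕ) (lam : ℝ) (V : (p : ℕ) → (Fin p → Pt d) → ℝ) (p : ℕ)
    {n : ℕ} (ks : Fin n → ℕ) (r : Fin n → Fin d → ℤ) : ℝ≥0∞ :=
  ⨆ (x : Fin p → Pt d) (_ : ∃ c : Fin p → Fin n,
      (∀ i, x i ∈ cube d lam (r (c i))) ∧
      ∀ b, (Finset.univ.filter fun i => c i = b).card = ks b),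
    ENNReal.ofReal |min (V p x) 0|

/-- The analogue of `IblocksT` where the number of points to be put in the cube labelled `s`
is prescribed by the function `κ`. -/
def IblocksF (d : ℕ) (lam : ℝ) (V : (p : ℕ) → (Fin p → Pt d) → ℝ) (p : ℕ)
    (κ : (Fin d → ℤ) → ℕ) : ℝ≥0∞ :=
  ⨆ (x : Fin p → Pt d) (_ : ∃ c : Fin p → Fin d → ℤ,
      (∀ i, x i ∈ cube d lam (c i)) ∧
      ∀ s, (Finset.univ.filter fun i => c i = s).card = κ s),
    ENNReal.ofReal |min (V p x) 0|

/-- `I_p^{k|m}(Δ)`: the sum over all ordered `m`-tuples of cubes `(Δ_1,…,Δ_m)` of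
`I_p^{k,1,…,1}(Δ,Δ_1,…,Δ_m)`, where `Δ` is the cube labelled `r`. -/
def Ikm (d : ℕ) (lam : ℝ) (V : (p : ℕ) → (Fin p → Pt d) → ℝ) (p k m : ℕ)
    (r : Fin d → ℤ) : ℝ≥0∞ :=
  ∑' rs : Fin m → Fin d → ℤ,
    IblocksT d lam V p (Fin.cons k fun _ => 1) (Fin.cons r rs)

/-- `I_p^{k | {k_1,…,k_m}}(Δ)`: the sum over all unordered families of pairwise distinct
cubes, all different from `Δ`, carrying the multiset of counts `K`, of the corresponding
`I_p^{k,k_{π(1)},…,k_{π(m)}}(Δ,Δ_1,…,Δ_m)` (distinct rearrangements counted once). -/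
def IpartSet (d : ℕ) (lam : ℝ) (V : (p : ℕ) → (Fin p → Pt d) → ℝ) (p : ℕ)
    (k : ℕ) (K : Multiset ℕ) (r : Fin d → ℤ) : ℝ≥0∞ :=
  ∑' κ : {κ : (Fin d → ℤ) → ℕ //
      κ r = 0 ∧ ∃ S : Finset (Fin d → ℤ), (∀ s, κ s ≠ 0 ↔ s ∈ S) ∧ S.val.map κ = K},
    IblocksF d lam V p (Function.update (κ : (Fin d → ℤ) → ℕ) r k)

/-- `V_p^p(Δ)`: the infimum of `V_p^+` over `p`-tuples of points of the cube labelled `r`. -/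
def Vpp (d : ℕ) (lam : ℝ) (V : (p : ℕ) → (Fin p → Pt d) → ℝ) (p : ℕ)
    (r : Fin d → ℤ) : ℝ :=
  ⨅ x : {x : Fin p → Pt d // ∀ i, x i ∈ cube d lam r}, max (V p (x : Fin p → Pt d)) 0

/-- Evaluation of `V_p` on a `p`-element finite set of points (well defined for symmetric
`V_p`). -/
def evalSubset (d : ℕ) (V : (p : ℕ) → (Fin p → Pt d) → ℝ) (p : ℕ) (η : Finset (Pt d)) : ℝ :=
  if h : η.toList.length = p then V p (fun i => η.toList.get (Fin.cast h.symm i)) else 0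

/-- `U^{(p)}(γ) = Σ_{{x_1,…,x_p} ⊂ γ} V_p(x_1,…,x_p)`. -/
def pEnergy (d : ℕ) (V : (p : ℕ) → (Fin p → Pt d) → ℝ) (p : ℕ) (γ : Finset (Pt d)) : ℝ :=
  ∑ η ∈ γ.powersetCard p, evalSubset d V p η

/-- `U(γ) = Σ_{p ≥ 2} U^{(p)}(γ)`. -/
def energy (d : ℕ) (V : (p : ℕ) → (Fin p → Pt d) → ℝ) (γ : Finset (Pt d)) : ℝ :=
  ∑ p ∈ Finset.Icc 2 γ.card, pEnergy d V p γ

/-- Assumptions A1–A4 of the paper. -/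
structure ManyBodyAssumptions (d : ℕ) (lam : ℝ)
    (V : (p : ℕ) → (Fin p → Pt d) → ℝ) : Prop where
  /-- A1: symmetry. -/
  symm : ∀ p, 2 ≤ p → ∀ (x : Fin p → Pt d) (π : Equiv.Perm (Fin p)), V p (x ∘ π) = V p x
  /-- A2: translation invariance. -/
  transl : ∀ p, 2 ≤ p → ∀ (x : Fin p → Pt d) (a : Pt d), V p (fun i => x i + a) = V p x
  /-- A3: repulsion for small distances. -/
  repel : ∀ p, 2 ≤ p → ∀ (r : Fin d → ℤ) (x : Fin p → Pt d),
    (∀ i, x i ∈ cube d lam r) → 0 ≤ V p x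
  /-- A4: integrability. -/
  integrable : ∀ p (hp : 2 ≤ p) k (hk1 : 1 ≤ k) (hk2 : k ≤ p - 1),
    (⨆ y : Fin k → Pt d, ∫⁻ z : Fin (p - k) → Pt d,
      ENNReal.ofReal |min (V p (joinAt p k (by omega) y z)) 0|) < ⊤

end
/-- The label of the cube containing `x`. -/
noncomputable def cubeLabel (d : ℕ) (lam : ℝ) (x : Pt d) : Fin d → ℤ := fun i => ⌊x i / lam + 1 / 2⌋

theorem mem_cube_iff {d : ℕ} {lam : ℝ} (hlam : 0 < lam) (x : Pt d) (r : Fin d → ℤ) :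
    x ∈ cube d lam r ↔ cubeLabel d lam x = r := by
  simp only [cube, Set.mem_ofPred_eq, funext_iff, cubeLabel, Int.floor_eq_iff]
  refine forall_congr' fun i => and_congr ?_ ?_
  · rw [← sub_le_iff_le_add, le_div_iff₀ hlam, mul_comm]
  · rw [← lt_sub_iff_add_lt, div_lt_iff₀ hlam, mul_comm lam]
    ring_nf

theorem mem_cube_cubeLabel {d : ℕ} {lam : ℝ} (hlam : 0 < lam) (x : Pt d) :
    x ∈ cube d lam (cubeLabel d lam x) :=
  (mem_cube_iff hlam x _).2 rfl

open scoped Classical in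
theorem occupancy_eq {d : ℕ} {lam : ℝ} (hlam : 0 < lam) (γ : Finset (Pt d)) (r : Fin d → ℤ) :
    occupancy d lam γ r = (γ.filter fun x => cubeLabel d lam x = r).card := by
  simp only [occupancy, mem_cube_iff hlam]

open scoped Classical in
theorem sum_occupancy {d : ℕ} {lam : ℝ} (hlam : 0 < lam) (γ : Finset (Pt d)) :
    ∑ r ∈ γ.image (cubeLabel d lam), occupancy d lam γ r = γ.card := by
  simp only [occupancy_eq hlam]
  exact (Finset.card_eq_sum_card_image _ _).symm

theorem pow_le_pow_mul_choose {n p : ℕ} (h : p ≤ n) : n ^ p ≤ p ^ p * n.choose p := by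
  have key : n ^ p * p.factorial ≤ p ^ p * n.descFactorial p := by
    rw [← Nat.descFactorial_self, Nat.descFactorial_eq_prod_range,
      Nat.descFactorial_eq_prod_range]
    conv_lhs => rw [← Finset.card_range p, ← Finset.prod_const, Finset.card_range]
    conv_rhs => rw [← Finset.card_range p, ← Finset.prod_const, Finset.card_range]
    rw [← Finset.prod_mul_distrib, ← Finset.prod_mul_distrib]
    refine Finset.prod_le_prod' fun i hi => ?_
    rw [Nat.mul_sub, Nat.mul_sub, mul_comm n p]
    exact Nat.sub_le_sub_left (Nat.mul_le_mul_right i h) _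
  rw [Nat.descFactorial_eq_factorial_mul_choose] at key
  refine Nat.le_of_mul_le_mul_right (key.trans_eq ?_) p.factorial_pos
  ring

theorem prod_le_sum_pow {m : ℕ} (f : Fin (m + 1) → ℕ) :
    ∏ i, f i ≤ ∑ i, f i ^ (m + 1) := by
  obtain ⟨i, -, hi⟩ := Finset.exists_max_image Finset.univ f Finset.univ_nonempty
  calc ∏ j, f j ≤ ∏ _j : Fin (m + 1), f i := Finset.prod_le_prod' fun j hj => hi j hj
    _ = f i ^ (m + 1) := by simp
    _ ≤ _ := Finset.single_le_sum (f := fun j => f j ^ (m + 1)) (fun _ _ => Nat.zero_le _)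
      (Finset.mem_univ i)

/-- The supremum of `|V_p^-|` over tuples whose `i`-th point lies in the cube labelled `c i`. -/
noncomputable def labelledSup (d : ℕ) (lam : ℝ) (V : (p : ℕ) → (Fin p → Pt d) → ℝ) (p : ℕ)
    (c : Fin p → Fin d → ℤ) : ℝ≥0∞ :=
  ⨆ (x : Fin p → Pt d) (_ : ∀ i, x i ∈ cube d lam (c i)), ENNReal.ofReal |min (V p x) 0|

theorem labelledSup_insertNth_le {d : ℕ} {lam : ℝ} (V : (p : ℕ) → (Fin p → Pt d) → ℝ) {m : ℕ}
    (i : Fin (m + 1)) (r : Fin d → ℤ) (rs : Fin m → Fin d → ℤ) :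
    labelledSup d lam V (m + 1) (i.insertNth (α := fun _ => Fin d → ℤ) r rs) ≤
      IblocksT d lam V (m + 1) (Fin.cons 1 fun _ => 1) (Fin.cons r rs) := by
  refine iSup₂_le fun x hx => ?_
  refine le_iSup₂_of_le x ⟨i.insertNth (α := fun _ => Fin (m + 1)) 0 Fin.succ, ?_, ?_⟩ le_rfl
  · intro j
    have := hx j
    revert this
    refine Fin.succAboveCases i ?_ (fun k => ?_) j <;> simp
  · have hinj : Function.Injective (i.insertNth (α := fun _ => Fin (m + 1)) 0 Fin.succ) := by
      intro a b
      refine Fin.succAboveCases i ?_ (fun k => ?_) a <;>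
      refine Fin.succAboveCases i ?_ (fun l => ?_) b <;> simp [Fin.succ_ne_zero, eq_comm]
    intro b
    obtain ⟨a, rfl⟩ := Finite.surjective_of_injective hinj b
    have h1 : ∀ b : Fin (m + 1), (Fin.cons 1 (fun _ => 1) : Fin (m + 1) → ℕ) b = 1 :=
      Fin.cases rfl fun _ => rfl
    simp [h1, hinj.eq_iff, Finset.filter_eq']

theorem tsum_labelledSup_le {d : ℕ} {lam : ℝ} (V : (p : ℕ) → (Fin p → Pt d) → ℝ) {m : ℕ}
    (i : Fin (m + 1)) (w : (Fin d → ℤ) → ℝ≥0∞) :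
    ∑' c : Fin (m + 1) → Fin d → ℤ, w (c i) * labelledSup d lam V (m + 1) c ≤
      ∑' r, w r * Ikm d lam V (m + 1) 1 m r := by
  rw [← (Fin.insertNthEquiv (fun _ => Fin d → ℤ) i).tsum_eq, ENNReal.tsum_prod']
  refine ENNReal.tsum_le_tsum fun r => ?_
  rw [Ikm, ← ENNReal.tsum_mul_left]
  refine ENNReal.tsum_le_tsum fun rs => ?_
  simpa [Fin.insertNthEquiv] using mul_le_mul_right (labelledSup_insertNth_le V i r rs) (w r)

open scoped Classical in
theorem sum_tuples_comp_label {d : ℕ} {lam : ℝ} (hlam : 0 < lam) (γ : Finset (Pt d)) (p : ℕ)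
    (f : (Fin p → Fin d → ℤ) → ℝ≥0∞) :
    ∑ x ∈ Fintype.piFinset (fun _ : Fin p => γ), f (fun i => cubeLabel d lam (x i)) =
      ∑ c ∈ Fintype.piFinset (fun _ : Fin p => γ.image (cubeLabel d lam)),
        ((∏ i, occupancy d lam γ (c i) : ℕ) : ℝ≥0∞) * f c := by
  rw [← Finset.sum_fiberwise_of_maps_to (g := fun x i => cubeLabel d lam (x i))
    (t := Fintype.piFinset (fun _ : Fin p => γ.image (cubeLabel d lam)))]
  · refine Finset.sum_congr rfl fun c _ => ?_
    rw [Finset.sum_congr rfl (g := fun _ => f c)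
      (fun x hx => by rw [(Finset.mem_filter.1 hx).2])]
    rw [Finset.sum_const, nsmul_eq_mul]
    congr 2
    simp only [occupancy_eq hlam]
    rw [← Fintype.card_piFinset]
    congr 1
    ext x
    simp [Fintype.mem_piFinset, funext_iff, forall_and]
  · intro x hx
    simp only [Fintype.mem_piFinset] at hx ⊢
    exact fun i => Finset.mem_image_of_mem _ (hx i)

open scoped Classical in
theorem sum_tuples_negPart_le {d : ℕ} {lam : ℝ} (hlam : 0 < lam)
    (V : (p : ℕ) → (Fin p → Pt d) → ℝ) (γ : Finset (Pt d)) (m : ℕ) :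
    ∑ x ∈ Fintype.piFinset (fun _ : Fin (m + 1) => γ), ENNReal.ofReal |min (V (m + 1) x) 0| ≤
      ∑ r ∈ γ.image (cubeLabel d lam), ((m + 1 : ℕ) : ℝ≥0∞) *
        ((occupancy d lam γ r : ℝ≥0∞) ^ (m + 1) * Ikm d lam V (m + 1) 1 m r) := by
  calc _ ≤ ∑ x ∈ Fintype.piFinset (fun _ : Fin (m + 1) => γ),
        labelledSup d lam V (m + 1) (fun i => cubeLabel d lam (x i)) :=
        Finset.sum_le_sum fun x _ =>
          le_iSup₂_of_le x (fun i => mem_cube_cubeLabel hlam (x i)) le_rfl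
    _ = _ := sum_tuples_comp_label hlam γ (m + 1) _
    _ ≤ ∑ c ∈ Fintype.piFinset (fun _ : Fin (m + 1) => γ.image (cubeLabel d lam)),
        ∑ i, (occupancy d lam γ (c i) : ℝ≥0∞) ^ (m + 1) * labelledSup d lam V (m + 1) c := by
        refine Finset.sum_le_sum fun c _ => ?_
        rw [← Finset.sum_mul]
        gcongr
        exact_mod_cast prod_le_sum_pow fun i => occupancy d lam γ (c i)
    _ = ∑ i, ∑ c ∈ Fintype.piFinset (fun _ : Fin (m + 1) => γ.image (cubeLabel d lam)),
        (occupancy d lam γ (c i) : ℝ≥0∞) ^ (m + 1) * labelledSup d lam V (m + 1) c :=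
        Finset.sum_comm
    _ ≤ ∑ _i : Fin (m + 1), ∑' r, (occupancy d lam γ r : ℝ≥0∞) ^ (m + 1) *
          Ikm d lam V (m + 1) 1 m r :=
        Finset.sum_le_sum fun i _ => (ENNReal.sum_le_tsum _).trans
          (tsum_labelledSup_le V i fun r => (occupancy d lam γ r : ℝ≥0∞) ^ (m + 1))
    _ = _ := by
        rw [Finset.sum_const, Finset.card_univ, Fintype.card_fin, nsmul_eq_mul,
          ← Finset.mul_sum, tsum_eq_sum]
        intro r hr
        have : occupancy d lam γ r = 0 := by
          rw [occupancy_eq hlam, Finset.card_eq_zero, Finset.filter_eq_empty_iff]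
          exact fun x hx h => hr (Finset.mem_image.2 ⟨x, hx, h⟩)
        simp [this]

/-- An enumeration of the points of a `p`-element set. -/
noncomputable def enum {d p : ℕ} (η : Finset (Pt d)) (h : η.card = p) : Fin p → Pt d :=
  fun i => η.toList.get (Fin.cast (by rw [Finset.length_toList, h]) i)

theorem enum_mem {d p : ℕ} (η : Finset (Pt d)) (h : η.card = p) (i : Fin p) :
    enum η h i ∈ η :=
  Finset.mem_toList.1 (List.get_mem _ _)

theorem exists_enum_eq {d p : ℕ} (η : Finset (Pt d)) (h : η.card = p) {x : Pt d} (hx : x ∈ η) :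
    ∃ i, enum η h i = x := by
  obtain ⟨j, hj⟩ := List.get_of_mem (Finset.mem_toList.2 hx)
  exact ⟨Fin.cast (by rw [Finset.length_toList, h]) j, by simpa [enum] using hj⟩

theorem evalSubset_eq {d p : ℕ} (V : (p : ℕ) → (Fin p → Pt d) → ℝ) (η : Finset (Pt d))
    (h : η.card = p) : evalSubset d V p η = V p (enum η h) :=
  dif_pos (by rw [Finset.length_toList, h])

open scoped Classical in
theorem sum_subsets_negPart_le {d p : ℕ} (V : (p : ℕ) → (Fin p → Pt d) → ℝ)
    (γ : Finset (Pt d)) :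
    ∑ η ∈ γ.powersetCard p, ENNReal.ofReal |min (evalSubset d V p η) 0| ≤
      ∑ x ∈ Fintype.piFinset (fun _ : Fin p => γ), ENNReal.ofReal |min (V p x) 0| := by
  rw [← Finset.sum_attach]
  have hc : ∀ η : {η // η ∈ γ.powersetCard p}, η.1.card = p :=
    fun η => (Finset.mem_powersetCard.1 η.2).2
  rw [Finset.sum_congr rfl (g := fun η : {η // η ∈ γ.powersetCard p} =>
    ENNReal.ofReal |min (V p (enum η.1 (hc η))) 0|)
    (fun η _ => by rw [evalSubset_eq V η.1 (hc η)])]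
  have hinj : Function.Injective
      fun η : {η // η ∈ γ.powersetCard p} => enum η.1 (hc η) := by
    have key : ∀ η ζ : {η // η ∈ γ.powersetCard p},
        enum η.1 (hc η) = enum ζ.1 (hc ζ) → η.1 ⊆ ζ.1 := by
      intro η ζ h x hx
      obtain ⟨i, rfl⟩ := exists_enum_eq η.1 (hc η) hx
      rw [h]
      exact enum_mem _ _ _
    exact fun η ζ h => Subtype.ext ((key η ζ h).antisymm (key ζ η h.symm))
  rw [← Finset.sum_image (f := fun x => ENNReal.ofReal |min (V p x) 0|)
    (g := fun η : {η // η ∈ γ.powersetCard p} => enum η.1 (hc η)) hinj.injOn]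
  refine Finset.sum_le_sum_of_subset fun x hx => ?_
  obtain ⟨η, -, rfl⟩ := Finset.mem_image.1 hx
  exact Fintype.mem_piFinset.2 fun i =>
    (Finset.mem_powersetCard.1 η.2).1 (enum_mem _ _ i)

theorem Vpp_nonneg {d : ℕ} {lam : ℝ} (V : (p : ℕ) → (Fin p → Pt d) → ℝ) (p : ℕ)
    (r : Fin d → ℤ) : 0 ≤ Vpp d lam V p r :=
  Real.iInf_nonneg fun _ => le_max_right _ _

open scoped Classical in
theorem sum_choose_mul_Vpp_le {d p : ℕ} {lam : ℝ} (hlam : 0 < lam) (hp : p ≠ 0)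
    (V : (p : ℕ) → (Fin p → Pt d) → ℝ) (γ : Finset (Pt d)) :
    ∑ r ∈ γ.image (cubeLabel d lam), ((occupancy d lam γ r).choose p : ℝ) * Vpp d lam V p r ≤
      ∑ η ∈ γ.powersetCard p, max (evalSubset d V p η) 0 := by
  set F : (Fin d → ℤ) → Finset (Finset (Pt d)) := fun r =>
    (γ.filter fun x => cubeLabel d lam x = r).powersetCard p with hF
  calc _ ≤ ∑ r ∈ γ.image (cubeLabel d lam), ∑ η ∈ F r, max (evalSubset d V p η) 0 := by
        refine Finset.sum_le_sum fun r _ => ?_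
        rw [occupancy_eq hlam, ← Finset.card_powersetCard, ← nsmul_eq_mul]
        refine Finset.card_nsmul_le_sum _ _ _ fun η hη => ?_
        obtain ⟨hsub, hcard⟩ := Finset.mem_powersetCard.1 hη
        rw [evalSubset_eq V η hcard]
        have hmem : ∀ i, enum η hcard i ∈ cube d lam r := fun i =>
          (mem_cube_iff hlam _ _).2 (Finset.mem_filter.1 (hsub (enum_mem η hcard i))).2
        exact ciInf_le (f := fun x : {x : Fin p → Pt d // ∀ i, x i ∈ cube d lam r} =>
          max (V p x.1) 0) ⟨0, by rintro _ ⟨x, rfl⟩; exact le_max_right _ _⟩ ⟨_, hmem⟩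
    _ = ∑ η ∈ (γ.image (cubeLabel d lam)).biUnion F, max (evalSubset d V p η) 0 := by
        refine (Finset.sum_biUnion fun r _ s _ hrs => ?_).symm
        refine Finset.disjoint_left.2 fun η hη hη' => hrs ?_
        obtain ⟨hsub, hcard⟩ := Finset.mem_powersetCard.1 hη
        obtain ⟨x, hx⟩ := Finset.card_pos.1 (hcard ▸ Nat.pos_of_ne_zero hp)
        rw [← (Finset.mem_filter.1 (hsub hx)).2,
          (Finset.mem_filter.1 ((Finset.mem_powersetCard.1 hη').1 hx)).2]
    _ ≤ _ := by
        refine Finset.sum_le_sum_of_subset_of_nonneg ?_ fun _ _ _ => le_max_right _ _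
        exact Finset.biUnion_subset.2 fun r _ =>
          Finset.powersetCard_mono (Finset.filter_subset _ _)

theorem cube_translate {d : ℕ} {lam : ℝ} {x : Pt d} {r : Fin d → ℤ} (a : Fin d → ℤ)
    (hx : x ∈ cube d lam r) :
    x + WithLp.toLp 2 (fun i => lam * (a i : ℝ)) ∈ cube d lam (r + a) := by
  intro i
  have := hx i
  simp only [PiLp.add_apply, Pi.add_apply, Int.cast_add]
  constructor <;> linarith

theorem IblocksT_le_translate {d : ℕ} {lam : ℝ} {V : (p : ℕ) → (Fin p → Pt d) → ℝ} {p : ℕ}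
    (hV : ∀ (x : Fin p → Pt d) (a : Pt d), V p (fun i => x i + a) = V p x)
    {n : ℕ} (ks : Fin n → ℕ) (r : Fin n → Fin d → ℤ) (a : Fin d → ℤ) :
    IblocksT d lam V p ks r ≤ IblocksT d lam V p ks (fun j => r j + a) := by
  refine iSup₂_le fun x ⟨c, hc, hk⟩ => ?_
  refine le_iSup₂_of_le (fun i => x i + WithLp.toLp 2 (fun i => lam * (a i : ℝ)))
    ⟨c, fun i => cube_translate a (hc i), hk⟩ ?_
  rw [hV]

theorem Ikm_le_Ikm_zero {d : ℕ} {lam : ℝ} {V : (p : ℕ) → (Fin p → Pt d) → ℝ} {p : ℕ}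
    (hV : ∀ (x : Fin p → Pt d) (a : Pt d), V p (fun i => x i + a) = V p x)
    (k m : ℕ) (r : Fin d → ℤ) : Ikm d lam V p k m r ≤ Ikm d lam V p k m 0 := by
  rw [Ikm, Ikm, ← (Equiv.addRight (fun _ : Fin m => -r)).tsum_eq
    (fun rs => IblocksT d lam V p (Fin.cons k fun _ => 1) (Fin.cons 0 rs))]
  refine ENNReal.tsum_le_tsum fun rs => ?_
  refine (IblocksT_le_translate hV _ _ (-r)).trans_eq ?_
  congr 1
  funext j
  refine Fin.cases ?_ (fun j => ?_) j <;> simp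

open scoped Classical in
theorem neg_le_pEnergy {d : ℕ} {lam : ℝ} (hlam : 0 < lam)
    {V : (p : ℕ) → (Fin p → Pt d) → ℝ} {m : ℕ}
    (hV : ∀ (x : Fin (m + 1) → Pt d) (a : Pt d), V (m + 1) (fun i => x i + a) = V (m + 1) x)
    (hrep : ∀ r : Fin d → ℤ, 0 ≤ Vpp d lam V (m + 1) r / ((m + 1 : ℕ) : ℝ) ^ (m + 1) -
      ((m + 1 : ℕ) : ℝ) * (Ikm d lam V (m + 1) 1 m r).toReal)
    (hfin : Ikm d lam V (m + 1) 1 m 0 ≠ ⊤) (γ : Finset (Pt d)) :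
    -(((m + 1 : ℕ) : ℝ) ^ (m + 2) * (Ikm d lam V (m + 1) 1 m 0).toReal * γ.card) ≤
      pEnergy d V (m + 1) γ := by
  set S := γ.image (cubeLabel d lam)
  set n := occupancy d lam γ
  set I : (Fin d → ℤ) → ℝ := fun r => (Ikm d lam V (m + 1) 1 m r).toReal
  set P : ℝ := ((m + 1 : ℕ) : ℝ) with hP
  have hP1 : 1 ≤ P := by simp [hP]
  have hI0 : ∀ r, 0 ≤ I r := fun r => ENNReal.toReal_nonneg
  have hI : ∀ r, I r ≤ I 0 := fun r => ENNReal.toReal_mono hfin (Ikm_le_Ikm_zero hV _ _ _)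
  have hIfin : ∀ r, Ikm d lam V (m + 1) 1 m r ≠ ⊤ := fun r =>
    ne_top_of_le_ne_top hfin (Ikm_le_Ikm_zero hV _ _ _)
  have hneg : ∑ η ∈ γ.powersetCard (m + 1), |min (evalSubset d V (m + 1) η) 0| ≤
      ∑ r ∈ S, P * ((n r : ℝ) ^ (m + 1) * I r) := by
    have h := (sum_subsets_negPart_le V γ).trans (sum_tuples_negPart_le hlam V γ m)
    rw [← ENNReal.ofReal_sum_of_nonneg fun _ _ => abs_nonneg _] at h
    have hterm : ∀ r ∈ S, ((m + 1 : ℕ) : ℝ≥0∞) *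
        ((n r : ℝ≥0∞) ^ (m + 1) * Ikm d lam V (m + 1) 1 m r) ≠ ⊤ := fun r _ =>
      ENNReal.mul_ne_top (ENNReal.natCast_ne_top _)
        (ENNReal.mul_ne_top (ENNReal.pow_ne_top (ENNReal.natCast_ne_top _)) (hIfin r))
    have h' := (ENNReal.ofReal_le_iff_le_toReal (ENNReal.sum_ne_top.2 hterm)).1 h
    rw [ENNReal.toReal_sum hterm] at h'
    simpa only [ENNReal.toReal_mul, ENNReal.toReal_pow, ENNReal.toReal_natCast] using h'
  have hpos := sum_choose_mul_Vpp_le hlam m.succ_ne_zero V γ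
  have hsplit : pEnergy d V (m + 1) γ =
      ∑ η ∈ γ.powersetCard (m + 1), max (evalSubset d V (m + 1) η) 0 -
        ∑ η ∈ γ.powersetCard (m + 1), |min (evalSubset d V (m + 1) η) 0| := by
    rw [pEnergy, ← Finset.sum_sub_distrib]
    refine Finset.sum_congr rfl fun η _ => ?_
    rw [abs_of_nonpos (min_le_right _ _), sub_neg_eq_add, max_add_min, add_zero]
  have hcell : ∀ r, -(P ^ (m + 2) * I 0 * n r) ≤
      ((n r).choose (m + 1) : ℝ) * Vpp d lam V (m + 1) r - P * ((n r : ℝ) ^ (m + 1) * I r) := by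
    intro r
    have hB : 0 ≤ P ^ (m + 2) * I 0 * n r := by have := hI0 0; positivity
    have hW := Vpp_nonneg (lam := lam) V (m + 1) r
    rcases le_or_gt (m + 1) (n r) with h | h
    · have hc : (n r : ℝ) ^ (m + 1) ≤ P ^ (m + 1) * (n r).choose (m + 1) := by
        rw [hP]
        exact_mod_cast pow_le_pow_mul_choose h
      have h2 : P * I r ≤ Vpp d lam V (m + 1) r / P ^ (m + 1) := sub_nonneg.1 (hrep r)
      have : P * ((n r : ℝ) ^ (m + 1) * I r) ≤
          ((n r).choose (m + 1) : ℝ) * Vpp d lam V (m + 1) r := by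
        calc P * ((n r : ℝ) ^ (m + 1) * I r) = (n r : ℝ) ^ (m + 1) * (P * I r) := by ring
          _ ≤ (P ^ (m + 1) * (n r).choose (m + 1)) *
              (Vpp d lam V (m + 1) r / P ^ (m + 1)) := by
              have := hI0 r
              gcongr
          _ = _ := by field_simp
      linarith
    · have hnP : (n r : ℝ) ≤ P := Nat.cast_le.2 h.le
      have h3 : P * ((n r : ℝ) ^ (m + 1) * I r) ≤ P ^ (m + 2) * I 0 * n r := by
        have := hI0 r
        have := hI0 0
        calc P * ((n r : ℝ) ^ (m + 1) * I r) = P * ((n r : ℝ) ^ m * I r) * n r := by ring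
          _ ≤ P * (P ^ m * I 0) * n r := by
              have := hI r
              gcongr
          _ = P ^ (m + 1) * I 0 * n r := by ring
          _ ≤ _ := by gcongr; omega
      have : 0 ≤ ((n r).choose (m + 1) : ℝ) * Vpp d lam V (m + 1) r := by positivity
      linarith
  have hsum := Finset.sum_le_sum fun r (_ : r ∈ S) => hcell r
  rw [Finset.sum_neg_distrib, ← Finset.mul_sum, Finset.sum_sub_distrib, ← Nat.cast_sum,
    sum_occupancy hlam γ] at hsum
  rw [hsplit]
  linarith

theorem statement1 (d : ℕ) (hd : 1 ≤ d) (lam : ℝ) (hlam : 0 < lam)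
    (V : (p : ℕ) → (Fin p → Pt d) → ℝ) (HA : ManyBodyAssumptions d lam V)
    (A B₂ : ℝ) (hA : 0 < A) (hB₂ : 0 ≤ B₂)
    (hstab : ∀ γ : Finset (Pt d),
      A * (∑' r : Fin d → ℤ, (occupancy d lam γ r : ℝ) ^ 2) - B₂ * γ.card
        ≤ pEnergy d V 2 γ)
    (h1 : ∀ p, 2 < p → ∀ r : Fin d → ℤ,
      0 ≤ Vpp d lam V p r / (p : ℝ) ^ p - (p : ℝ) * (Ikm d lam V p 1 (p - 1) r).toReal)
    (h2 : ∀ r : Fin d → ℤ,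
      (∑' p : ℕ, if 2 < p then (p : ℝ≥0∞) ^ (p + 1) * Ikm d lam V p 1 (p - 1) r else 0) ≠ ⊤) :
    ∀ γ : Finset (Pt d),
      A * (∑' r : Fin d → ℤ, (occupancy d lam γ r : ℝ) ^ 2)
        - (B₂ + (∑' p : ℕ,
            if 2 < p then (p : ℝ≥0∞) ^ (p + 1) * Ikm d lam V p 1 (p - 1) 0 else 0).toReal)
          * γ.card
      ≤ energy d V γ := by
  intro γ
  set T : ℕ → ℝ≥0∞ := fun p =>
    if 2 < p then (p : ℝ≥0∞) ^ (p + 1) * Ikm d lam V p 1 (p - 1) 0 else 0 with hT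
  have hTsum : ∑' p, T p ≠ ⊤ := h2 0
  have hTp : ∀ p, T p ≠ ⊤ := fun p => ENNReal.ne_top_of_tsum_ne_top hTsum p
  have hbound : ∀ p, 2 < p → -((T p).toReal * γ.card) ≤ pEnergy d V p γ := by
    intro p hp
    have hTeq : T p = (p : ℝ≥0∞) ^ (p + 1) * Ikm d lam V p 1 (p - 1) 0 := if_pos hp
    have hfin : Ikm d lam V p 1 (p - 1) 0 ≠ ⊤ := by
      intro h
      have := hTp p
      rw [hTeq, h, ENNReal.mul_top (pow_ne_zero _ (Nat.cast_ne_zero.2 (by omega)))] at this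
      exact this rfl
    rw [hTeq, ENNReal.toReal_mul, ENNReal.toReal_pow, ENNReal.toReal_natCast]
    obtain ⟨m, rfl⟩ : ∃ m, p = m + 1 := ⟨p - 1, by omega⟩
    exact neg_le_pEnergy hlam (HA.transl _ (by omega)) (h1 _ hp) hfin γ
  have hT0 : ∑ p ∈ Finset.Icc 3 γ.card, (T p).toReal ≤ (∑' p, T p).toReal := by
    rw [← ENNReal.toReal_sum fun p _ => hTp p]
    exact ENNReal.toReal_mono hTsum (ENNReal.sum_le_tsum _)
  have henergy : energy d V γ =
      pEnergy d V 2 γ + ∑ p ∈ Finset.Icc 3 γ.card, pEnergy d V p γ := by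
    rcases le_or_gt 2 γ.card with h | h
    · rw [energy, ← Finset.add_sum_Ioc_eq_sum_Icc h]
      rfl
    · rw [energy, Finset.Icc_eq_empty (by omega), Finset.Icc_eq_empty (by omega), pEnergy,
        Finset.powersetCard_eq_empty.2 h]
      simp
  have hsum : -((∑' p, T p).toReal * γ.card) ≤ ∑ p ∈ Finset.Icc 3 γ.card, pEnergy d V p γ := by
    calc -((∑' p, T p).toReal * γ.card) ≤
          -((∑ p ∈ Finset.Icc 3 γ.card, (T p).toReal) * γ.card) :=
          neg_le_neg (mul_le_mul_of_nonneg_right hT0 (Nat.cast_nonneg _))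
      _ = ∑ p ∈ Finset.Icc 3 γ.card, -((T p).toReal * γ.card) := by
          rw [Finset.sum_neg_distrib, Finset.sum_mul]
      _ ≤ _ := Finset.sum_le_sum fun p hp => hbound p (Finset.mem_Icc.1 hp).1
  have h := hstab γ
  rw [henergy]
  linarith
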